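/- Let f ∈ rbmo(μ) and let φ be a C¹ function with compact support on ℝ^d. Then the pointwise product fφ belongs to rbmo(μ). -/

import Mathlib

open MeasureTheory Metric Set Filter
open scoped ENNReal NNReal BigOperators Topology

noncomputable section

/-- Euclidean space `ℝ^d`. -/
abbrev Euc (d : ℕ) := EuclideanSpace ℝ (Fin d)

/-- A (closed, axis-parallel) cube in `ℝ^d`, given by its center and side length. -/
structure Cube (d : ℕ) where
  center : Euc d
  side : ℝ

namespace Cube

/-- The underlying set of a cube. -/
def set {d : ℕ} (Q : Cube d) : Set (Euc d) :=
  {y : Euc d | ∀ i, |y i - Q.center i| ≤ Q.side / 2}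

/-- The concentric dilate `αQ` of a cube. -/
def dilate {d : ℕ} (Q : Cube d) (α : ℝ) : Cube d := ⟨Q.center, α * Q.side⟩

end Cube

/-- `Q` is a genuine cube for `μ`: positive side length, centered at a point of `supp μ`. -/
def IsCube {d : ℕ} (μ : Measure (Euc d)) (Q : Cube d) : Prop :=
  0 < Q.side ∧ ∀ r : ℝ, 0 < r → 0 < μ (Metric.ball Q.center r)

/-- The mean value `f_Q = μ(Q)⁻¹ ∫_Q f dμ`. -/
def cubeAvg {d : ℕ} (μ : Measure (Euc d)) (Q : Cube d) (f : Euc d → ℝ) : ℝ :=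
  (μ Q.set).toReal⁻¹ * ∫ x in Q.set, f x ∂μ

/-- `N_{Q,R}`: the smallest positive integer `k` with `2^k ℓ(Q) ≥ ℓ(R)`. -/
def NQR {d : ℕ} (Q R : Cube d) : ℕ :=
  sInf {k : ℕ | 0 < k ∧ R.side ≤ 2 ^ k * Q.side}

/-- The Tolsa coefficient `S_{Q,R} = 1 + ∑_{k=1}^{N_{Q,R}} μ(2^k Q)/ℓ(2^k Q)^n`. -/
def SQR {d : ℕ} (μ : Measure (Euc d)) (n : ℕ) (Q R : Cube d) : ℝ :=
  1 + ∑ k ∈ Finset.Icc 1 (NQR Q R),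
      (μ (Q.dilate (2 ^ k)).set).toReal / (2 ^ k * Q.side) ^ n

/-- `Q` is `(α,β)`-doubling: `μ(αQ) ≤ β μ(Q)`. -/
def IsDoubling {d : ℕ} (μ : Measure (Euc d)) (α β : ℝ) (Q : Cube d) : Prop :=
  μ (Q.dilate α).set ≤ ENNReal.ofReal β * μ Q.set

/-- `Q̃ = 2^N Q`, `N` the smallest non-negative integer making `2^N Q` `(ρ,β)`-doubling. -/
def tilde {d : ℕ} (μ : Measure (Euc d)) (ρ β : ℝ) (Q : Cube d) : Cube d :=
  Q.dilate (2 ^ sInf {N : ℕ | IsDoubling μ ρ β (Q.dilate (2 ^ N))})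

/-- `C` is an `RBMO(μ)` bound for `f` (with parameters `η, ρ, β`). -/
def RBMOBound {d : ℕ} (μ : Measure (Euc d)) (n : ℕ) (η ρ β : ℝ)
    (f : Euc d → ℝ) (C : ℝ) : Prop :=
  (∀ Q : Cube d, IsCube μ Q →
      ∫ x in Q.set, |f x - cubeAvg μ (tilde μ ρ β Q) f| ∂μ
        ≤ C * (μ (Q.dilate η).set).toReal) ∧
  (∀ Q R : Cube d, IsCube μ Q → IsCube μ R → Q.set ⊆ R.set →
      IsDoubling μ ρ β Q → IsDoubling μ ρ β R →
      |cubeAvg μ Q f - cubeAvg μ R f| ≤ C * SQR μ n Q R)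

/-- `f ∈ RBMO(μ)`. -/
def MemRBMO {d : ℕ} (μ : Measure (Euc d)) (n : ℕ) (η ρ β : ℝ) (f : Euc d → ℝ) : Prop :=
  LocallyIntegrable f μ ∧ ∃ C : ℝ, 0 ≤ C ∧ RBMOBound μ n η ρ β f C

/-- The `RBMO(μ)` norm of `f`. -/
def rbmoNorm {d : ℕ} (μ : Measure (Euc d)) (n : ℕ) (η ρ β : ℝ) (f : Euc d → ℝ) : ℝ :=
  sInf {C : ℝ | 0 ≤ C ∧ RBMOBound μ n η ρ β f C}

/-- `C` is an `rbmo(μ)` (local `RBMO`) bound for `f`. -/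
def RbmoLocBound {d : ℕ} (μ : Measure (Euc d)) (n : ℕ) (η ρ β : ℝ)
    (f : Euc d → ℝ) (C : ℝ) : Prop :=
  (∀ Q : Cube d, IsCube μ Q → Q.side ≤ 1 →
      ∫ x in Q.set, |f x - cubeAvg μ (tilde μ ρ β Q) f| ∂μ
        ≤ C * (μ (Q.dilate η).set).toReal) ∧
  (∀ Q R : Cube d, IsCube μ Q → IsCube μ R → Q.side ≤ 1 → Q.set ⊆ R.set →
      IsDoubling μ ρ β Q → IsDoubling μ ρ β R →
      |cubeAvg μ Q f - cubeAvg μ R f| ≤ C * SQR μ n Q R) ∧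
  (∀ Q : Cube d, IsCube μ Q → 1 < Q.side →
      ∫ x in Q.set, |f x| ∂μ ≤ C * (μ (Q.dilate η).set).toReal)

/-- `f ∈ rbmo(μ)`. -/
def MemRbmoLoc {d : ℕ} (μ : Measure (Euc d)) (n : ℕ) (η ρ β : ℝ) (f : Euc d → ℝ) : Prop :=
  LocallyIntegrable f μ ∧ ∃ C : ℝ, 0 ≤ C ∧ RbmoLocBound μ n η ρ β f C

/-- The `rbmo(μ)` norm of `f`. -/
def rbmoLocNorm {d : ℕ} (μ : Measure (Euc d)) (n : ℕ) (η ρ β : ℝ) (f : Euc d → ℝ) : ℝ :=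
  sInf {C : ℝ | 0 ≤ C ∧ RbmoLocBound μ n η ρ β f C}

/-- The data of an `∞`-block: `b = ∑ λ_j a_j`, supported in `R`, with `a_j` supported
in `Q_j ⊂ R` and `‖a_j‖_{L^∞(μ)} ≤ (μ(2Q_j) S_{Q_j,R})⁻¹`, `∑_j |λ_j| < ∞`. -/
structure PreBlock {d : ℕ} (μ : Measure (Euc d)) (n : ℕ) : Type where
  R : Cube d
  Qs : ℕ → Cube d
  lam : ℕ → ℝ
  a : ℕ → Euc d → ℝ
  isCubeR : IsCube μ R
  isCubeQs : ∀ j, IsCube μ (Qs j)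
  subsetQR : ∀ j, (Qs j).set ⊆ R.set
  measA : ∀ j, Measurable (a j)
  suppA : ∀ j, Function.support (a j) ⊆ (Qs j).set
  boundA : ∀ j x, |a j x| ≤ ((μ ((Qs j).dilate 2).set).toReal * SQR μ n (Qs j) R)⁻¹
  summable : Summable fun j => |lam j|

/-- The function determined by a block. -/
def PreBlock.fn {d : ℕ} {μ : Measure (Euc d)} {n : ℕ} (b : PreBlock μ n) : Euc d → ℝ :=
  fun x => ∑' j, b.lam j * b.a j x

/-- `|b| = ∑_j |λ_j|`. -/
def PreBlock.size {d : ℕ} {μ : Measure (Euc d)} {n : ℕ} (b : PreBlock μ n) : ℝ :=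
  ∑' j, |b.lam j|

/-- An `∞`-atomic block: an `∞`-block with vanishing integral. -/
structure AtomicBlock {d : ℕ} (μ : Measure (Euc d)) (n : ℕ) extends PreBlock μ n where
  cancel : ∫ x, (∑' j, lam j * a j x) ∂μ = 0

/-- The function determined by an atomic block. -/
def AtomicBlock.fn {d : ℕ} {μ : Measure (Euc d)} {n : ℕ} (b : AtomicBlock μ n) : Euc d → ℝ :=
  b.toPreBlock.fn

/-- `|b|_{H¹} = ∑_j |λ_j|`. -/
def AtomicBlock.size {d : ℕ} {μ : Measure (Euc d)} {n : ℕ} (b : AtomicBlock μ n) : ℝ :=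
  b.toPreBlock.size

/-- The class of test functions `F(x)` of Tolsa's grand maximal function. -/
def TestFun {d : ℕ} (μ : Measure (Euc d)) (n : ℕ) (x : Euc d) (φ : Euc d → ℝ) : Prop :=
  Integrable φ μ ∧ ContDiff ℝ 1 φ ∧ (∫ y, |φ y| ∂μ) ≤ 1 ∧
  (∀ y, 0 ≤ φ y) ∧ (∀ y, y ≠ x → φ y ≤ (‖y - x‖ ^ n)⁻¹) ∧
  (∀ y, y ≠ x → ‖fderiv ℝ φ y‖ ≤ (‖y - x‖ ^ (n + 1))⁻¹)

/-- The grand maximal function `M f(x) = sup_{φ ∈ F(x)} |∫ f φ dμ|`. -/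
def grandM {d : ℕ} (μ : Measure (Euc d)) (n : ℕ) (f : Euc d → ℝ) (x : Euc d) : ℝ :=
  sSup {r : ℝ | ∃ φ : Euc d → ℝ, TestFun μ n x φ ∧ r = |∫ y, f y * φ y ∂μ|}

/-- The local class `F_loc(x)`: test functions supported in the cube `Q(x,1)`. -/
def TestFunLoc {d : ℕ} (μ : Measure (Euc d)) (n : ℕ) (x : Euc d) (φ : Euc d → ℝ) : Prop :=
  TestFun μ n x φ ∧ Function.support φ ⊆ (Cube.mk x 1).set

/-- The local grand maximal function `M^{(1)} f(x) = sup_{φ ∈ F_loc(x)} |∫ f φ dμ|`. -/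
def grandMLoc {d : ℕ} (μ : Measure (Euc d)) (n : ℕ) (f : Euc d → ℝ) (x : Euc d) : ℝ :=
  sSup {r : ℝ | ∃ φ : Euc d → ℝ, TestFunLoc μ n x φ ∧ r = |∫ y, f y * φ y ∂μ|}

/-- The Orlicz quasi-norm of `u` on the set `E`, for the Orlicz function `P`
(with value `∞` when no admissible constant exists). -/
def orliczNormOn {α : Type*} [MeasurableSpace α] (P : ℝ → ℝ) (lam : Measure α)
    (E : Set α) (u : α → ℝ) : ℝ≥0∞ :=
  sInf {k : ℝ≥0∞ | 0 < k ∧ k ≠ ∞ ∧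
    ∫⁻ x in E, ENNReal.ofReal (P (|u x| / k.toReal)) ∂lam ≤ 1}

/-- The Orlicz quasi-norm of `u`. -/
def orliczNorm {α : Type*} [MeasurableSpace α] (P : ℝ → ℝ) (lam : Measure α)
    (u : α → ℝ) : ℝ≥0∞ :=
  orliczNormOn P lam Set.univ u

/-- `℘(t) = t / log(e+t)`. -/
def wp (t : ℝ) : ℝ := t / Real.log (Real.exp 1 + t)

/-- `℘̃(t) = t · log(e+t)`. -/
def wpDual (t : ℝ) : ℝ := t * Real.log (Real.exp 1 + t)

/-- `Ξ(t) = e^t − 1`. -/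
def XiFun (t : ℝ) : ℝ := Real.exp t - 1

/-- `dν(x) = dμ(x)/log(e+|x|)`. -/
def nuMeas {d : ℕ} (μ : Measure (Euc d)) : Measure (Euc d) :=
  μ.withDensity fun x => ENNReal.ofReal (Real.log (Real.exp 1 + ‖x‖))⁻¹

/-- `dσ(x) = dμ(x)/(1+|x|)^{2n+κ}`. -/
def sigmaMeas {d : ℕ} (μ : Measure (Euc d)) (n : ℕ) (κ : ℝ) : Measure (Euc d) :=
  μ.withDensity fun x => ENNReal.ofReal (((1 + ‖x‖) ^ (2 * (n : ℝ) + κ))⁻¹)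

/-- The unit cube `m + [0,1)^d` of the lattice `ℤ^d`. -/
def latCube (d : ℕ) (m : Fin d → ℤ) : Set (Euc d) :=
  {x : Euc d | ∀ i, (m i : ℝ) ≤ x i ∧ x i < (m i : ℝ) + 1}

/-! ### Elementary facts on cubes -/

namespace Cube

variable {d : ℕ}

lemma isClosed_set (Q : Cube d) : IsClosed Q.set := by
  have : Q.set = ⋂ i, {y : Euc d | |y i - Q.center i| ≤ Q.side / 2} := by
    ext y; simp [Cube.set]
  rw [this]
  exact isClosed_iInter fun i => isClosed_le (by fun_prop) continuous_const

lemma measurableSet_set (Q : Cube d) : MeasurableSet Q.set :=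
  Q.isClosed_set.measurableSet

lemma norm_sub_le_of_coord {x y : Euc d} {s : ℝ} (hs : 0 ≤ s) (h : ∀ i, |x i - y i| ≤ s) :
    ‖x - y‖ ≤ √d * s := by
  rw [EuclideanSpace.norm_eq, Real.sqrt_le_iff]
  refine ⟨by positivity, ?_⟩
  calc ∑ i, ‖(x - y) i‖ ^ 2 ≤ ∑ _i : Fin d, s ^ 2 :=
        Finset.sum_le_sum fun i _ => pow_le_pow_left₀ (norm_nonneg _) (by simpa using h i) 2
    _ = (√d * s) ^ 2 := by
        rw [mul_pow, Real.sq_sqrt (Nat.cast_nonneg d)]; simp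

lemma norm_sub_le {Q : Cube d} (hQ : 0 ≤ Q.side) {x y : Euc d} (hx : x ∈ Q.set) (hy : y ∈ Q.set) :
    ‖x - y‖ ≤ √d * Q.side := by
  refine norm_sub_le_of_coord hQ fun i => ?_
  have h1 := abs_le.1 (hx i)
  have h2 := abs_le.1 (hy i)
  rw [abs_le]
  constructor <;> linarith

lemma isCompact_set (Q : Cube d) : IsCompact Q.set := by
  refine Metric.isCompact_of_isClosed_isBounded Q.isClosed_set ?_
  refine (isBounded_closedBall (x := Q.center) (r := √d * |Q.side / 2|)).subset fun y hy => ?_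
  rw [mem_closedBall, dist_eq_norm]
  exact norm_sub_le_of_coord (abs_nonneg _) fun i => (hy i).trans (le_abs_self _)

lemma set_mono (x : Euc d) {s t : ℝ} (h : s ≤ t) : (Cube.mk x s).set ⊆ (Cube.mk x t).set :=
  fun _ hy i => (hy i).trans (by simpa using by linarith)

lemma ball_subset_set (Q : Cube d) : ball Q.center (Q.side / 2) ⊆ Q.set := fun y hy i => by
  have h := PiLp.norm_apply_le (y - Q.center) i
  rw [mem_ball, dist_eq_norm] at hy
  simpa using h.trans hy.le

lemma center_mem_set {Q : Cube d} (hQ : 0 ≤ Q.side) : Q.center ∈ Q.set := fun i => by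
  simpa using by linarith

end Cube

section

variable {d n : ℕ} {μ : Measure (Euc d)} {C₀ η ρ β : ℝ}

lemma IsCube.resize {Q : Cube d} (hQ : IsCube μ Q) {t : ℝ} (ht : 0 < t) :
    IsCube μ ⟨Q.center, t⟩ := ⟨ht, hQ.2⟩

lemma IsCube.dilate {Q : Cube d} (hQ : IsCube μ Q) {t : ℝ} (ht : 0 < t) :
    IsCube μ (Q.dilate t) := ⟨mul_pos ht hQ.1, hQ.2⟩

lemma IsCube.measure_ne_top
    (hμ : ∀ Q : Cube d, IsCube μ Q → μ Q.set ≤ ENNReal.ofReal (C₀ * Q.side ^ n))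
    {Q : Cube d} (hQ : IsCube μ Q) : μ Q.set ≠ ∞ :=
  ((hμ Q hQ).trans_lt ENNReal.ofReal_lt_top).ne

lemma IsCube.toReal_pos
    (hμ : ∀ Q : Cube d, IsCube μ Q → μ Q.set ≤ ENNReal.ofReal (C₀ * Q.side ^ n))
    {Q : Cube d} (hQ : IsCube μ Q) : 0 < (μ Q.set).toReal :=
  ENNReal.toReal_pos
    ((hQ.2 _ (half_pos hQ.1)).trans_le (measure_mono Q.ball_subset_set)).ne'
    (hQ.measure_ne_top hμ)

lemma IsCube.toReal_le (hC₀ : 0 < C₀)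
    (hμ : ∀ Q : Cube d, IsCube μ Q → μ Q.set ≤ ENNReal.ofReal (C₀ * Q.side ^ n))
    {Q : Cube d} (hQ : IsCube μ Q) : (μ Q.set).toReal ≤ C₀ * Q.side ^ n :=
  ENNReal.toReal_le_of_le_ofReal (mul_nonneg hC₀.le (pow_nonneg hQ.1.le n)) (hμ Q hQ)

lemma IsCube.toReal_mono
    (hμ : ∀ Q : Cube d, IsCube μ Q → μ Q.set ≤ ENNReal.ofReal (C₀ * Q.side ^ n))
    {R : Cube d} (hR : IsCube μ R) {s : Set (Euc d)} (h : s ⊆ R.set) :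
    (μ s).toReal ≤ (μ R.set).toReal :=
  ENNReal.toReal_mono (hR.measure_ne_top hμ) (measure_mono h)

lemma IsDoubling.toReal_le
    (hμ : ∀ Q : Cube d, IsCube μ Q → μ Q.set ≤ ENNReal.ofReal (C₀ * Q.side ^ n))
    (hβ : 0 ≤ β) (hηρ : η ≤ ρ) {Q : Cube d} (hQ : IsCube μ Q)
    (h : IsDoubling μ ρ β Q) : (μ (Q.dilate η).set).toReal ≤ β * (μ Q.set).toReal := by
  have hsub : (Q.dilate η).set ⊆ (Q.dilate ρ).set :=
    Cube.set_mono _ (mul_le_mul_of_nonneg_right hηρ hQ.1.le)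
  have h' := (measure_mono (μ := μ) hsub).trans h
  have := ENNReal.toReal_mono (ENNReal.mul_ne_top ENNReal.ofReal_ne_top (hQ.measure_ne_top hμ)) h'
  rwa [ENNReal.toReal_mul, ENNReal.toReal_ofReal hβ] at this

lemma mul_toReal_le_of_not_isDoubling
    (hμ : ∀ Q : Cube d, IsCube μ Q → μ Q.set ≤ ENNReal.ofReal (C₀ * Q.side ^ n))
    (hβ : 0 ≤ β) (hρ : 0 < ρ) {Q : Cube d} (hQ : IsCube μ Q)
    (h : ¬ IsDoubling μ ρ β Q) : β * (μ Q.set).toReal ≤ (μ (Q.dilate ρ).set).toReal := by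
  have := ENNReal.toReal_mono ((hQ.dilate hρ).measure_ne_top hμ) (not_le.1 h).le
  rwa [ENNReal.toReal_mul, ENNReal.toReal_ofReal hβ] at this

/-- A centre of a cube has doubling cubes among the cubes of side `ρ ^ J * s`, and the density
of the nondoubling ones that come before the first doubling one decays geometrically. -/
lemma exists_isDoubling_pow
    (hC₀ : 0 < C₀)
    (hμ : ∀ Q : Cube d, IsCube μ Q → μ Q.set ≤ ENNReal.ofReal (C₀ * Q.side ^ n))
    (hρ : 1 < ρ) (hβ : ρ ^ n < β) {Q : Cube d} (hQ : IsCube μ Q) :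
    ∃ J : ℕ, IsDoubling μ ρ β (Q.dilate (ρ ^ J)) ∧ ∀ i ≤ J,
      (μ (Q.dilate (ρ ^ i)).set).toReal ≤
        C₀ * (ρ ^ i * Q.side) ^ n * (ρ ^ n / β) ^ (J - i) := by
  have hρ0 : 0 < ρ := zero_lt_one.trans hρ
  have hβ0 : 0 < β := (pow_pos hρ0 n).trans hβ
  have hcube (i : ℕ) : IsCube μ (Q.dilate (ρ ^ i)) := hQ.dilate (pow_pos hρ0 i)
  have hdecay (J : ℕ) (hJ : ∀ i < J, ¬ IsDoubling μ ρ β (Q.dilate (ρ ^ i))) :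
      ∀ k ≤ J, (μ (Q.dilate (ρ ^ (J - k))).set).toReal ≤
        C₀ * (ρ ^ (J - k) * Q.side) ^ n * (ρ ^ n / β) ^ k := by
    intro k
    induction k with
    | zero => intro _; simpa [Cube.dilate] using (hcube J).toReal_le hC₀ hμ
    | succ k ih =>
      intro hk
      obtain ⟨i, rfl⟩ : ∃ i, J = i + (k + 1) := ⟨J - (k + 1), by omega⟩
      have h1 := ih (by omega)
      have h2 := mul_toReal_le_of_not_isDoubling hμ hβ0.le hρ0 (hcube i) (hJ i (by omega))
      have e1 : i + (k + 1) - k = i + 1 := by omega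
      have e2 : (Q.dilate (ρ ^ i)).dilate ρ = Q.dilate (ρ ^ (i + 1)) := by
        simp only [Cube.dilate]; congr 1; ring
      rw [e1] at h1
      rw [e2] at h2
      rw [Nat.add_sub_cancel]
      refine le_of_mul_le_mul_left ((h2.trans h1).trans_eq ?_) hβ0
      rw [pow_succ (ρ ^ n / β), pow_succ ρ, mul_pow (ρ ^ i * ρ), mul_pow (ρ ^ i) ρ,
        mul_pow (ρ ^ i) Q.side]
      field_simp
  have hθ0 : 0 < ρ ^ n / β := div_pos (pow_pos hρ0 n) hβ0
  have hθ1 : ρ ^ n / β < 1 := (div_lt_one hβ0).2 hβ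
  have hex : ∃ J, IsDoubling μ ρ β (Q.dilate (ρ ^ J)) := by
    by_contra! hno
    have h0 := hQ.toReal_pos hμ
    have hlim : Tendsto (fun J : ℕ => C₀ * Q.side ^ n * (ρ ^ n / β) ^ J) atTop (𝓝 0) := by
      simpa using (tendsto_pow_atTop_nhds_zero_of_lt_one hθ0.le hθ1).const_mul (C₀ * Q.side ^ n)
    obtain ⟨J, hJ⟩ := (hlim.eventually_lt_const h0).exists
    have := hdecay J (fun i _ => hno i) J le_rfl
    simp only [Cube.dilate, Nat.sub_self, pow_zero, one_mul] at this
    exact absurd hJ (not_lt.2 this)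
  classical
  refine ⟨Nat.find hex, Nat.find_spec hex, fun i hi => ?_⟩
  have := hdecay _ (fun i hi => Nat.find_min hex hi) (Nat.find hex - i) (Nat.sub_le _ _)
  rwa [Nat.sub_sub_self hi] at this

lemma two_pow_mul_side_lt {Q R : Cube d} {k : ℕ} (hk : 0 < k) (hkN : k < NQR Q R) :
    2 ^ k * Q.side < R.side := by
  by_contra! h
  exact Nat.notMem_of_lt_sInf hkN ⟨hk, h⟩

/-- Every small cube is contained in a doubling cube of side larger than `1` for which the
Tolsa coefficient is controlled by the side of the small cube. -/
lemma exists_isDoubling_SQR_le (hC₀ : 0 < C₀)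
    (hμ : ∀ Q : Cube d, IsCube μ Q → μ Q.set ≤ ENNReal.ofReal (C₀ * Q.side ^ n))
    (hρ : 1 < ρ) (hβ : ρ ^ n < β) :
    ∃ K : ℝ, 0 ≤ K ∧ ∀ Q : Cube d, IsCube μ Q → Q.side ≤ 1 →
      ∃ R : Cube d, IsCube μ R ∧ 1 < R.side ∧ Q.set ⊆ R.set ∧ IsDoubling μ ρ β R ∧
        Q.side * SQR μ n Q R ≤ K := by
  have hρ0 : 0 < ρ := zero_lt_one.trans hρ
  have hβ1 : 1 < β := (one_le_pow₀ hρ.le).trans_lt hβ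
  have hβ0 : 0 < β := zero_lt_one.trans hβ1
  set θ : ℝ := ρ ^ n / β with hθ
  have hθ0 : 0 < θ := div_pos (pow_pos hρ0 n) hβ0
  have hθ1 : θ < 1 := (div_lt_one hβ0).2 hβ
  obtain ⟨m, hm⟩ := pow_unbounded_of_one_lt ρ (one_lt_two (α := ℝ))
  have hm0 : 0 < m := by
    rcases Nat.eq_zero_or_pos m with rfl | h
    · norm_num at hm; linarith
    · exact h
  have hmR : (1 : ℝ) ≤ m := by exact_mod_cast hm0
  obtain ⟨q, hq0, hq1, hqθ⟩ : ∃ q : ℝ, 0 < q ∧ q < 1 ∧ θ ≤ q ^ m := by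
    have h1 : (1 - θ) / m ≤ 1 - θ := div_le_self (by linarith) hmR
    have h2 : 0 < (1 - θ) / m := div_pos (by linarith) (by linarith)
    refine ⟨1 + -((1 - θ) / m), by linarith, by linarith, ?_⟩
    refine le_trans (le_of_eq ?_) (one_add_mul_le_pow (by linarith) m)
    field_simp
    ring
  set A : ℝ := C₀ * β / q with hA
  have hAC : C₀ ≤ A := by
    rw [hA, le_div_iff₀ hq0]
    exact mul_le_mul_of_nonneg_left (hq1.le.trans hβ1.le) hC₀.le
  have hA0 : 0 < A := hC₀.trans_le hAC
  refine ⟨1 + 2 * C₀ + A / (1 - q), ?_, fun Q hQ hQ1 => ?_⟩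
  · have : 0 < A / (1 - q) := div_pos hA0 (by linarith)
    positivity
  obtain ⟨J, hJ, hdec⟩ := exists_isDoubling_pow hC₀ hμ hρ hβ (hQ.resize (t := 2) two_pos)
  have hρJ : 1 ≤ ρ ^ J := one_le_pow₀ hρ.le
  set R : Cube d := (Cube.mk Q.center 2).dilate (ρ ^ J)
  have hRs : R.side = ρ ^ J * 2 := rfl
  refine ⟨R, ⟨by rw [hRs]; positivity, hQ.2⟩, by rw [hRs]; linarith,
    Cube.set_mono Q.center (s := Q.side) (by linarith), hJ, ?_⟩
  have hN (k : ℕ) : 0 < k → k < NQR Q R → 2 ^ k * Q.side < R.side := two_pow_mul_side_lt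
  set N := NQR Q R
  have hl := hQ.1
  have hterm (k : ℕ) : 0 < k → k ≤ N →
      (μ (Q.dilate (2 ^ k)).set).toReal / (2 ^ k * Q.side) ^ n ≤
        (if 2 ^ k * Q.side ≤ 2 then C₀ else 0) + A * q ^ (N - k) := by
    intro hk0 hkN
    have hu : 0 < 2 ^ k * Q.side := by positivity
    have htriv : (μ (Q.dilate (2 ^ k)).set).toReal / (2 ^ k * Q.side) ^ n ≤ C₀ := by
      rw [div_le_iff₀ (by positivity)]
      exact (hQ.dilate (by positivity)).toReal_le hC₀ hμ
    split_ifs with hk2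
    · have : 0 ≤ A * q ^ (N - k) := by positivity
      linarith
    rw [zero_add]
    rcases hkN.eq_or_lt with rfl | hkN
    · simpa using htriv.trans hAC
    obtain ⟨i, hi1, hi2⟩ := exists_nat_pow_near
      (show 1 ≤ 2 ^ k * Q.side / 2 by linarith) hρ
    have hkT := hN k hk0 hkN
    have hNT := hN (N - 1) (by omega) (by omega)
    rw [hRs] at hkT hNT
    have hiJ : i < J := (pow_lt_pow_iff_right₀ hρ).1 (by linarith)
    obtain ⟨j, rfl⟩ : ∃ j, J = i + 1 + j := ⟨J - (i + 1), by omega⟩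
    obtain ⟨p, hp⟩ : ∃ p, N = k + 1 + p := ⟨N - (k + 1), by omega⟩
    have e1 : N - 1 = k + p := by omega
    have e2 : N - k = p + 1 := by omega
    have hpm : p < m * (j + 1) := by
      have h1 : (2 : ℝ) ^ p < ρ ^ (j + 1) := by
        rw [e1, pow_add] at hNT
        have h3 : 2 ^ p * (2 ^ k * Q.side) < ρ ^ (j + 1) * (ρ ^ i * 2) := by
          calc 2 ^ p * (2 ^ k * Q.side) = 2 ^ k * 2 ^ p * Q.side := by ring
            _ < _ := hNT
            _ = _ := by ring
        have h4 : ρ ^ i * 2 ≤ 2 ^ k * Q.side := by linarith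
        have h5 : 0 < ρ ^ i * 2 := by positivity
        exact lt_of_mul_lt_mul_right
          ((mul_le_mul_of_nonneg_left h4 (by positivity)).trans_lt h3) h5.le
      have h2 : (2 : ℝ) ^ p < 2 ^ (m * (j + 1)) := by
        rw [pow_mul]
        exact h1.trans_le (pow_le_pow_left₀ hρ0.le hm.le _)
      exact (pow_lt_pow_iff_right₀ one_lt_two).1 h2
    have hθq : θ ^ (j + 1) ≤ q ^ p :=
      calc θ ^ (j + 1) ≤ (q ^ m) ^ (j + 1) := pow_le_pow_left₀ hθ0.le hqθ _
        _ = q ^ (m * (j + 1)) := (pow_mul q m (j + 1)).symm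
        _ ≤ q ^ p := pow_le_pow_of_le_one hq0.le hq1.le hpm.le
    have hd := hdec (i + 1) (by omega)
    have hsub : (Q.dilate (2 ^ k)).set ⊆ ((Cube.mk Q.center 2).dilate (ρ ^ (i + 1))).set :=
      Cube.set_mono _ (by simp only; linarith)
    have hmono := IsCube.toReal_mono hμ
      ((hQ.resize (t := 2) two_pos).dilate (pow_pos hρ0 (i + 1))) hsub
    rw [e2, div_le_iff₀ (by positivity)]
    calc (μ (Q.dilate (2 ^ k)).set).toReal
        ≤ C₀ * (ρ ^ (i + 1) * 2) ^ n * θ ^ j := by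
          refine hmono.trans (hd.trans_eq ?_)
          rw [Nat.add_sub_cancel_left]
      _ = C₀ * β * θ ^ (j + 1) * (ρ ^ i * 2) ^ n := by
          have : β * θ = ρ ^ n := by rw [hθ]; field_simp
          rw [pow_succ ρ, mul_right_comm (ρ ^ i) ρ 2, mul_pow (ρ ^ i * 2), ← this, pow_succ θ]
          ring
      _ ≤ C₀ * β * q ^ p * (2 ^ k * Q.side) ^ n := by
          exact mul_le_mul (mul_le_mul_of_nonneg_left hθq (by positivity))
            (pow_le_pow_left₀ (by positivity) (by linarith) n) (by positivity) (by positivity)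
      _ = A * q ^ (p + 1) * (2 ^ k * Q.side) ^ n := by
          rw [hA, pow_succ]; field_simp
  have hcount : ∑ k ∈ Finset.Icc 1 N, (if 2 ^ k * Q.side ≤ 2 then C₀ else 0) ≤
      2 / Q.side * C₀ := by
    rw [← Finset.sum_filter, Finset.sum_const, nsmul_eq_mul]
    refine mul_le_mul_of_nonneg_right ?_ hC₀.le
    have hsub : (Finset.Icc 1 N).filter (fun k => 2 ^ k * Q.side ≤ 2) ⊆
        Finset.Icc 1 ⌊2 / Q.side⌋₊ := by
      intro k hk
      rw [Finset.mem_filter, Finset.mem_Icc] at hk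
      rw [Finset.mem_Icc]
      refine ⟨hk.1.1, Nat.le_floor ?_⟩
      rw [le_div_iff₀ hl]
      refine le_trans (mul_le_mul_of_nonneg_right ?_ hl.le) hk.2
      exact_mod_cast (Nat.lt_two_pow_self (n := k)).le
    have hcard := Finset.card_le_card hsub
    rw [Nat.card_Icc, Nat.add_sub_cancel] at hcard
    exact (Nat.cast_le.2 hcard).trans (Nat.floor_le (by positivity))
  have hgeom : ∑ k ∈ Finset.Icc 1 N, A * q ^ (N - k) ≤ A / (1 - q) := by
    rw [← Finset.mul_sum, div_eq_mul_inv]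
    refine mul_le_mul_of_nonneg_left ?_ hA0.le
    have hre : ∑ k ∈ Finset.Icc 1 N, q ^ (N - k) = ∑ k ∈ Finset.range N, q ^ k := by
      refine Finset.sum_nbij' (fun k => N - k) (fun k => N - k) ?_ ?_ ?_ ?_ fun _ _ => rfl <;>
        simp only [Finset.mem_Icc, Finset.mem_range] <;> omega
    rw [hre, ← tsum_geometric_of_lt_one hq0.le hq1]
    exact (summable_geometric_of_lt_one hq0.le hq1).sum_le_tsum _ fun _ _ => by positivity
  have hS : SQR μ n Q R ≤ 1 + (2 / Q.side * C₀ + A / (1 - q)) := by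
    unfold SQR
    refine add_le_add_right ?_ 1
    refine le_trans (Finset.sum_le_sum fun k hk => ?_)
      ((Finset.sum_add_distrib).trans_le (add_le_add hcount hgeom))
    rw [Finset.mem_Icc] at hk
    exact hterm k hk.1 hk.2
  have hg : 0 ≤ A / (1 - q) := div_nonneg hA0.le (by linarith)
  calc Q.side * SQR μ n Q R ≤ Q.side * (1 + (2 / Q.side * C₀ + A / (1 - q))) :=
        mul_le_mul_of_nonneg_left hS hl.le
    _ = Q.side + 2 * C₀ + Q.side * (A / (1 - q)) := by field_simp; ring
    _ ≤ 1 + 2 * C₀ + A / (1 - q) := by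
        have := mul_le_of_le_one_left hg hQ1
        linarith

lemma integrableOn_cube {f : Euc d → ℝ} (hf : LocallyIntegrable f μ)
    (Q : Cube d) : IntegrableOn f Q.set μ :=
  hf.integrableOn_isCompact Q.isCompact_set

lemma abs_cubeAvg_mul_toReal_le
    (hμ : ∀ Q : Cube d, IsCube μ Q → μ Q.set ≤ ENNReal.ofReal (C₀ * Q.side ^ n))
    {f : Euc d → ℝ} {Q : Cube d} (hQ : IsCube μ Q) :
    |cubeAvg μ Q f| * (μ Q.set).toReal ≤ ∫ x in Q.set, |f x| ∂μ := by
  have h0 := hQ.toReal_pos hμ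
  rw [cubeAvg, abs_mul, abs_of_pos (inv_pos.2 h0), mul_comm, mul_inv_cancel_left₀ h0.ne']
  exact abs_integral_le_integral_abs

/-- The averages of an `rbmo` function over small doubling cubes do not grow faster than the
inverse of the side. -/
lemma exists_min_side_mul_abs_cubeAvg_le (hC₀ : 0 < C₀)
    (hμ : ∀ Q : Cube d, IsCube μ Q → μ Q.set ≤ ENNReal.ofReal (C₀ * Q.side ^ n))
    (hηρ : η ≤ ρ) (hρ : 1 < ρ) (hβ : ρ ^ n < β) {f : Euc d → ℝ} {C : ℝ} (hC : 0 ≤ C)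
    (hf : RbmoLocBound μ n η ρ β f C) :
    ∃ K : ℝ, 0 ≤ K ∧ ∀ Q : Cube d, IsCube μ Q → IsDoubling μ ρ β Q →
      min 1 Q.side * |cubeAvg μ Q f| ≤ K := by
  have hβ0 : 0 < β := (pow_pos (zero_lt_one.trans hρ) n).trans hβ
  obtain ⟨K, hK, hS⟩ := exists_isDoubling_SQR_le hC₀ hμ hρ hβ
  have hlarge (Q : Cube d) (hQ : IsCube μ Q) (h1 : 1 < Q.side) (hd : IsDoubling μ ρ β Q) :
      |cubeAvg μ Q f| ≤ C * β := by
    refine le_of_mul_le_mul_right ?_ (hQ.toReal_pos hμ)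
    calc _ ≤ ∫ x in Q.set, |f x| ∂μ := abs_cubeAvg_mul_toReal_le hμ hQ
      _ ≤ C * (μ (Q.dilate η).set).toReal := hf.2.2 Q hQ h1
      _ ≤ C * (β * (μ Q.set).toReal) :=
        mul_le_mul_of_nonneg_left (hd.toReal_le hμ hβ0.le hηρ hQ) hC
      _ = _ := by ring
  refine ⟨C * K + C * β, by positivity, fun Q hQ hd => ?_⟩
  have hCK : 0 ≤ C * K := by positivity
  rcases lt_or_ge 1 Q.side with h1 | h1
  · rw [min_eq_left h1.le, one_mul]
    exact (hlarge Q hQ h1 hd).trans (by linarith)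
  · rw [min_eq_right h1]
    obtain ⟨R, hR, hR1, hQR, hRd, hSK⟩ := hS Q hQ h1
    have h2 := hf.2.1 Q R hQ hR h1 hQR hd hRd
    have h3 := hlarge R hR hR1 hRd
    have h4 : |cubeAvg μ Q f| ≤ C * SQR μ n Q R + C * β := by
      have := abs_sub_abs_le_abs_sub (cubeAvg μ Q f) (cubeAvg μ R f)
      linarith
    calc Q.side * |cubeAvg μ Q f| ≤ Q.side * (C * SQR μ n Q R + C * β) :=
          mul_le_mul_of_nonneg_left h4 hQ.1.le
      _ = C * (Q.side * SQR μ n Q R) + Q.side * (C * β) := by ring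
      _ ≤ C * K + C * β := add_le_add (mul_le_mul_of_nonneg_left hSK hC)
          (mul_le_of_le_one_left (by positivity) h1)

lemma isDoubling_tilde {Q : Cube d} (h : ∃ N : ℕ, IsDoubling μ ρ β (Q.dilate (2 ^ N))) :
    IsDoubling μ ρ β (tilde μ ρ β Q) :=
  Nat.sInf_mem (s := {N : ℕ | IsDoubling μ ρ β (Q.dilate (2 ^ N))}) h

lemma tilde_eq_self {Q : Cube d} (h : ¬ ∃ N : ℕ, IsDoubling μ ρ β (Q.dilate (2 ^ N))) :
    tilde μ ρ β Q = Q := by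
  have he : {N : ℕ | IsDoubling μ ρ β (Q.dilate (2 ^ N))} = ∅ :=
    Set.eq_empty_iff_forall_notMem.2 fun N hN => h ⟨N, hN⟩
  rw [tilde, he, Nat.sInf_empty, pow_zero, Cube.dilate, one_mul]

lemma IsCube.tilde {Q : Cube d} (hQ : IsCube μ Q) : IsCube μ (tilde μ ρ β Q) :=
  hQ.dilate (by positivity)

lemma side_le_side_tilde {Q : Cube d} (hQ : 0 ≤ Q.side) : Q.side ≤ (tilde μ ρ β Q).side :=
  le_mul_of_one_le_left hQ (one_le_pow₀ one_le_two)

lemma set_subset_tilde {Q : Cube d} (hQ : 0 ≤ Q.side) : Q.set ⊆ (tilde μ ρ β Q).set :=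
  Cube.set_mono Q.center (side_le_side_tilde hQ)

/-- Every point of the support is the centre of a cube with side in `[s, 2s)` that has a
doubling dyadic dilate. -/
lemma exists_side_tilde_isDoubling (hC₀ : 0 < C₀)
    (hμ : ∀ Q : Cube d, IsCube μ Q → μ Q.set ≤ ENNReal.ofReal (C₀ * Q.side ^ n))
    (hρ : 1 < ρ) (hβ : ρ ^ n < β) {Q : Cube d} (hQ : IsCube μ Q) :
    ∃ r : ℝ, Q.side ≤ r ∧ r < 2 * Q.side ∧
      IsDoubling μ ρ β (tilde μ ρ β ⟨Q.center, r⟩) := by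
  obtain ⟨J, hJ, -⟩ := exists_isDoubling_pow hC₀ hμ hρ hβ hQ
  obtain ⟨N, hN1, hN2⟩ := exists_nat_pow_near (one_le_pow₀ (n := J) hρ.le)
    (one_lt_two (α := ℝ))
  have h2 : (0 : ℝ) < 2 ^ N := by positivity
  refine ⟨ρ ^ J / 2 ^ N * Q.side, ?_, ?_, ?_⟩
  · exact le_mul_of_one_le_left hQ.1.le ((one_le_div h2).2 hN1)
  · refine mul_lt_mul_of_pos_right ?_ hQ.1
    rwa [div_lt_iff₀ h2, ← pow_succ']
  · refine isDoubling_tilde ⟨N, ?_⟩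
    have e : (Cube.mk Q.center (ρ ^ J / 2 ^ N * Q.side)).dilate (2 ^ N) = Q.dilate (ρ ^ J) := by
      simp only [Cube.dilate]
      congr 1
      field_simp
    rwa [e]

lemma setIntegral_biUnion_le_sum {α ι : Type*} [MeasurableSpace α] {ν : Measure α} {g : α → ℝ}
    (hg : ∀ x, 0 ≤ g x) (F : Finset ι) (s : ι → Set α) (hs : ∀ i ∈ F, IntegrableOn g (s i) ν) :
    ∫ x in ⋃ i ∈ F, s i, g x ∂ν ≤ ∑ i ∈ F, ∫ x in s i, g x ∂ν := by
  classical
  induction F using Finset.induction_on with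
  | empty => simp
  | insert a F ha ih =>
    have h1 : IntegrableOn g (s a) ν := hs a (Finset.mem_insert_self a F)
    have h2 : IntegrableOn g (⋃ i ∈ F, s i) ν := (integrableOn_finset_iUnion).2 fun i hi =>
      hs i (Finset.mem_insert_of_mem hi)
    rw [Finset.set_biUnion_insert, Finset.sum_insert ha]
    calc ∫ x in s a ∪ ⋃ i ∈ F, s i, g x ∂ν
        ≤ ∫ x, g x ∂(ν.restrict (s a) + ν.restrict (⋃ i ∈ F, s i)) :=
          integral_mono_measure (Measure.restrict_union_le _ _) (ae_of_all _ hg)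
            (Integrable.add_measure h1 h2)
      _ = ∫ x in s a, g x ∂ν + ∫ x in ⋃ i ∈ F, s i, g x ∂ν := integral_add_measure h1 h2
      _ ≤ _ := add_le_add_right (ih fun i hi => hs i (Finset.mem_insert_of_mem hi)) _

/-- Any subset of a cube is covered by a controlled number of small cubes centred in it. -/
lemma exists_finset_cover (d : ℕ) {δ : ℝ} (hδ : 0 < δ) :
    ∃ N : ℕ, ∀ Q : Cube d, 0 < Q.side → ∀ E ⊆ Q.set, ∃ F : Finset (Euc d),
      (F : Set (Euc d)) ⊆ E ∧ F.card ≤ N ∧ ∀ z ∈ E, ∃ y ∈ F, ∀ i, |z i - y i| ≤ δ * Q.side := by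
  classical
  obtain ⟨T, hT, hcov⟩ := Metric.totallyBounded_iff.1
    (Cube.mk (0 : Euc d) 1).isCompact_set.totallyBounded (δ / 2) (half_pos hδ)
  refine ⟨hT.toFinset.card, fun Q hQ E hE => ?_⟩
  let P (t z : Euc d) : Prop := z ∈ E ∧ dist (Q.side⁻¹ • (z - Q.center)) t < δ / 2
  have hg : ∀ t : Euc d, ∃ y, (∃ z, P t z) → P t y := fun t => by
    by_cases h : ∃ z, P t z
    · exact ⟨h.choose, fun _ => h.choose_spec⟩
    · exact ⟨0, fun h' => (h h').elim⟩
  choose g hg using hg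
  refine ⟨(hT.toFinset.filter fun t => ∃ z, P t z).image g, ?_,
    Finset.card_image_le.trans (Finset.card_filter_le _ _), fun z hz => ?_⟩
  · intro y hy
    simp only [Finset.coe_image, Finset.coe_filter, Set.mem_image, Set.mem_ofPred_eq] at hy
    obtain ⟨t, ht, rfl⟩ := hy
    exact (hg t ht.2).1
  · have hz1 : Q.side⁻¹ • (z - Q.center) ∈ (Cube.mk (0 : Euc d) 1).set := fun i => by
      have := hE hz i
      simp only [PiLp.smul_apply, PiLp.sub_apply, smul_eq_mul, PiLp.zero_apply, sub_zero, abs_mul,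
        abs_inv, abs_of_pos hQ]
      rw [inv_mul_le_iff₀ hQ]
      linarith
    obtain ⟨t, ht, hzt⟩ := Set.mem_iUnion₂.1 (hcov hz1)
    have hPt : ∃ z, P t z := ⟨z, hz, hzt⟩
    refine ⟨g t, Finset.mem_image_of_mem g
      (Finset.mem_filter.2 ⟨hT.mem_toFinset.2 ht, hPt⟩), fun i => ?_⟩
    have h1 : dist (Q.side⁻¹ • (z - Q.center)) (Q.side⁻¹ • (g t - Q.center)) < δ := by
      have := dist_triangle_right (Q.side⁻¹ • (z - Q.center)) (Q.side⁻¹ • (g t - Q.center)) t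
      have h2 := (hg t hPt).2
      rw [mem_ball] at hzt
      linarith
    rw [dist_eq_norm, ← smul_sub, sub_sub_sub_cancel_right, norm_smul, norm_inv,
      Real.norm_of_nonneg hQ.le, inv_mul_lt_iff₀ hQ] at h1
    have h3 := PiLp.norm_apply_le (z - g t) i
    rw [Real.norm_eq_abs, PiLp.sub_apply] at h3
    linarith

/-- Averages of an `rbmo` function over a cube, relative to the measure of the `η`-dilate, do not
grow faster than the inverse of the side. -/
lemma exists_min_side_mul_integral_abs_le (hC₀ : 0 < C₀)
    (hμ : ∀ Q : Cube d, IsCube μ Q → μ Q.set ≤ ENNReal.ofReal (C₀ * Q.side ^ n))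
    (hη : 1 < η) (hηρ : η ≤ ρ) (hρ : 1 < ρ) (hβ : ρ ^ n < β) {f : Euc d → ℝ}
    (hfi : LocallyIntegrable f μ) {C : ℝ} (hC : 0 ≤ C) (hf : RbmoLocBound μ n η ρ β f C) :
    ∃ K : ℝ, 0 ≤ K ∧ ∀ Q : Cube d, IsCube μ Q →
      min 1 Q.side * ∫ x in Q.set, |f x| ∂μ ≤ K * (μ (Q.dilate η).set).toReal := by
  obtain ⟨K, hK, hKb⟩ := exists_min_side_mul_abs_cubeAvg_le hC₀ hμ hηρ hρ hβ hC hf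
  have hη0 : 0 < η := zero_lt_one.trans hη
  set ε : ℝ := (η - 1) / (2 * η) with hε
  have hε0 : 0 < ε := div_pos (by linarith) (by linarith)
  have hηε : η * ε = (η - 1) / 2 := by rw [hε]; field_simp
  have hε1 : 2 * ε < 1 := by
    rw [hε, ← mul_div_assoc, mul_div_mul_left _ _ two_ne_zero, div_lt_one hη0]
    linarith
  obtain ⟨N, hN⟩ := exists_finset_cover d (half_pos hε0)
  refine ⟨C + N * (C + K / ε), by positivity, fun Q hQ => ?_⟩
  have hl := hQ.1
  rcases lt_or_ge 1 Q.side with h1 | h1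
  · rw [min_eq_left h1.le, one_mul]
    refine (hf.2.2 Q hQ h1).trans (mul_le_mul_of_nonneg_right ?_ ENNReal.toReal_nonneg)
    have : 0 ≤ N * (C + K / ε) := by positivity
    linarith
  rw [min_eq_right h1]
  obtain ⟨F, hFE, hFN, hF⟩ := hN Q hl (Q.set ∩ μ.support) Set.inter_subset_left
  have hr : ∀ y : Euc d, ∃ r : ℝ, y ∈ μ.support → IsCube μ ⟨y, r⟩ ∧ ε * Q.side ≤ r ∧
      r < 2 * (ε * Q.side) ∧ IsDoubling μ ρ β (tilde μ ρ β ⟨y, r⟩) := fun y => by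
    by_cases hy : y ∈ μ.support
    · have hcube : IsCube μ ⟨y, ε * Q.side⟩ := ⟨mul_pos hε0 hl, fun r hr =>
        (Measure.mem_support_iff_forall y).1 hy _ (ball_mem_nhds y hr)⟩
      obtain ⟨r, hr1, hr2, hr3⟩ := exists_side_tilde_isDoubling hC₀ hμ hρ hβ hcube
      exact ⟨r, fun _ => ⟨hcube.resize (hcube.1.trans_le hr1), hr1, hr2, hr3⟩⟩
    · exact ⟨0, fun h => (hy h).elim⟩
  choose r hr using hr
  have hcov : (Q.set : Set (Euc d)) ≤ᵐ[μ] ⋃ y ∈ F, (Cube.mk y (r y)).set := by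
    filter_upwards [Measure.support_mem_ae (μ := μ)] with z hz hzQ
    obtain ⟨y, hy, hzy⟩ := hF z ⟨hzQ, hz⟩
    refine Set.mem_iUnion₂.2 ⟨y, hy, fun i => (hzy i).trans ?_⟩
    have := (hr y (hFE hy).2).2.1
    simp only
    linarith
  have hpiece : ∀ y ∈ F, Q.side * ∫ x in (Cube.mk y (r y)).set, |f x| ∂μ ≤
      (C + K / ε) * (μ (Q.dilate η).set).toReal := by
    intro y hy
    obtain ⟨hP, hr1, hr2, hd⟩ := hr y (hFE hy).2
    set P : Cube d := ⟨y, r y⟩ with hPdef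
    have hPs : P.side = r y := rfl
    have hPQ : (P.dilate η).set ⊆ (Q.dilate η).set := by
      intro z hz i
      have h3 := hz i
      have h4 := (hFE hy).1 i
      have h5 := abs_sub_le (z i) (y i) (Q.center i)
      have h6 : η * r y ≤ (η - 1) * Q.side := by
        calc η * r y ≤ η * (2 * (ε * Q.side)) := mul_le_mul_of_nonneg_left hr2.le hη0.le
          _ = 2 * (η * ε) * Q.side := by ring
          _ = _ := by rw [hηε]; ring
      simp only [Cube.dilate, hPdef] at h3 ⊢
      linarith
    have hP1 : P.side ≤ 1 := by
      have : 2 * ε * Q.side ≤ 1 := mul_le_one₀ hε1.le hl.le h1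
      linarith
    set c := cubeAvg μ (tilde μ ρ β P) f
    have hc : Q.side * |c| ≤ K / ε := by
      rw [le_div_iff₀ hε0]
      refine le_trans ?_ (hKb _ hP.tilde hd)
      rw [mul_right_comm]
      refine mul_le_mul_of_nonneg_right (le_min ?_ ?_) (abs_nonneg _)
      · exact mul_le_one₀ h1 hε0.le (by linarith)
      · rw [mul_comm]
        exact hr1.trans (side_le_side_tilde hP.1.le)
    have hci : IntegrableOn (fun _ : Euc d => c) P.set μ :=
      integrableOn_const (hP.measure_ne_top hμ)
    have hsplit : ∫ x in P.set, |f x| ∂μ ≤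
        ∫ x in P.set, |f x - c| ∂μ + |c| * (μ P.set).toReal := by
      have h7 : |c| * (μ P.set).toReal = ∫ _x in P.set, |c| ∂μ := by
        rw [setIntegral_const, smul_eq_mul, mul_comm]; rfl
      have h8 : IntegrableOn (fun x => f x - c) P.set μ := (integrableOn_cube hfi P).sub hci
      rw [h7, ← integral_add h8.abs hci.abs]
      refine integral_mono (integrableOn_cube hfi P).abs
        (h8.abs.add hci.abs) fun x => ?_
      have := abs_add_le (f x - c) c
      rwa [sub_add_cancel] at this
    have hosc := hf.1 P hP hP1
    have hPη : (μ (P.dilate η).set).toReal ≤ (μ (Q.dilate η).set).toReal :=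
      (hQ.dilate hη0).toReal_mono hμ hPQ
    have hPP : (μ P.set).toReal ≤ (μ (Q.dilate η).set).toReal := by
      refine le_trans ((hP.dilate hη0).toReal_mono hμ ?_) hPη
      exact Cube.set_mono y (le_mul_of_one_le_left hP.1.le hη.le)
    calc Q.side * ∫ x in P.set, |f x| ∂μ
        ≤ Q.side * (C * (μ (P.dilate η).set).toReal + |c| * (μ P.set).toReal) := by
          refine mul_le_mul_of_nonneg_left ?_ hl.le
          linarith
      _ = Q.side * (C * (μ (P.dilate η).set).toReal) +
          Q.side * |c| * (μ P.set).toReal := by ring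
      _ ≤ C * (μ (Q.dilate η).set).toReal + K / ε * (μ (Q.dilate η).set).toReal := by
          refine add_le_add ?_ ?_
          · exact (mul_le_of_le_one_left (by positivity) h1).trans
              (mul_le_mul_of_nonneg_left hPη hC)
          · exact mul_le_mul hc hPP ENNReal.toReal_nonneg (by positivity)
      _ = _ := by ring
  have hle : ∫ x in Q.set, |f x| ∂μ ≤ ∑ y ∈ F, ∫ x in (Cube.mk y (r y)).set, |f x| ∂μ := by
    have hint : ∀ y ∈ F, IntegrableOn (fun x => |f x|) (Cube.mk y (r y)).set μ :=
      fun y _ => (integrableOn_cube hfi _).abs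
    refine le_trans ?_ (setIntegral_biUnion_le_sum (fun x => abs_nonneg (f x)) F _ hint)
    exact setIntegral_mono_set (integrableOn_finset_iUnion.2 hint)
      (ae_of_all _ fun x => abs_nonneg _) hcov
  calc Q.side * ∫ x in Q.set, |f x| ∂μ
      ≤ ∑ y ∈ F, Q.side * ∫ x in (Cube.mk y (r y)).set, |f x| ∂μ := by
        rw [← Finset.mul_sum]
        exact mul_le_mul_of_nonneg_left hle hl.le
    _ ≤ F.card • ((C + K / ε) * (μ (Q.dilate η).set).toReal) :=
        Finset.sum_le_card_nsmul _ _ _ hpiece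
    _ ≤ N * ((C + K / ε) * (μ (Q.dilate η).set).toReal) := by
        rw [nsmul_eq_mul]
        exact mul_le_mul_of_nonneg_right (Nat.cast_le.2 hFN) (by positivity)
    _ ≤ (C + N * (C + K / ε)) * (μ (Q.dilate η).set).toReal := by
        rw [add_mul C (N * (C + K / ε)), mul_assoc (N : ℝ)]
        exact le_add_of_nonneg_left (by positivity)

lemma one_le_SQR {Q R : Cube d} (hQ : 0 ≤ Q.side) : 1 ≤ SQR μ n Q R :=
  le_add_of_nonneg_right (Finset.sum_nonneg fun _ _ => by positivity)

/-- A `C¹` function with compact support oscillates on a cube by at most a multiple of the side,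
and at most a multiple of `1`. -/
lemma exists_abs_sub_le_min_side {φ : Euc d → ℝ} (hφ : ContDiff ℝ 1 φ)
    (hφc : HasCompactSupport φ) :
    ∃ D : ℝ, 0 ≤ D ∧ ∀ Q : Cube d, 0 < Q.side → ∀ x ∈ Q.set, ∀ y ∈ Q.set,
      |φ x - φ y| ≤ D * min 1 Q.side := by
  obtain ⟨M, hM⟩ := hφ.continuous.bounded_above_of_compact_support hφc
  obtain ⟨L, hL⟩ := hφ.lipschitzWith_of_hasCompactSupport hφc one_ne_zero
  have hM0 : 0 ≤ M := (norm_nonneg _).trans (hM 0)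
  have hLd : 0 ≤ L * √d := by positivity
  refine ⟨2 * M + L * √d, by positivity, fun Q hQ x hx y hy => ?_⟩
  rw [mul_min_of_nonneg _ _ (by positivity)]
  refine le_min ?_ ?_
  · have h1 := norm_sub_le (φ x) (φ y)
    rw [Real.norm_eq_abs (φ x - φ y)] at h1
    linarith [hM x, hM y]
  · have h1 := hL.dist_le_mul x y
    rw [Real.dist_eq, dist_eq_norm] at h1
    calc |φ x - φ y| ≤ L * (√d * Q.side) :=
          h1.trans (mul_le_mul_of_nonneg_left (Cube.norm_sub_le hQ.le hx hy) L.2)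
      _ = L * √d * Q.side := by ring
      _ ≤ (2 * M + L * √d) * Q.side := by
          refine mul_le_mul_of_nonneg_right ?_ hQ.le
          linarith

/-- Multiplication by a function of small oscillation almost commutes with averaging. -/
lemma abs_cubeAvg_mul_sub_cubeAvg_mul_le
    (hμ : ∀ Q : Cube d, IsCube μ Q → μ Q.set ≤ ENNReal.ofReal (C₀ * Q.side ^ n))
    {f φ : Euc d → ℝ} (hf : LocallyIntegrable f μ) (hφ : Continuous φ)
    {Q : Cube d} (hQ : IsCube μ Q) {x : Euc d} {δ : ℝ}
    (hδ : ∀ y ∈ Q.set, |φ x - φ y| ≤ δ) :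
    |cubeAvg μ Q f * φ x - cubeAvg μ Q (fun y => f y * φ y)| * (μ Q.set).toReal ≤
      δ * ∫ y in Q.set, |f y| ∂μ := by
  have hfQ := integrableOn_cube hf Q
  have hfφ : IntegrableOn (fun y => f y * φ y) Q.set μ :=
    hfQ.mul_continuousOn hφ.continuousOn Q.isCompact_set
  have hfx : IntegrableOn (fun y => f y * φ x) Q.set μ := hfQ.mul_const (φ x)
  have e : cubeAvg μ Q f * φ x - cubeAvg μ Q (fun y => f y * φ y) =
      cubeAvg μ Q (fun y => f y * φ x - f y * φ y) := by
    simp only [cubeAvg]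
    rw [integral_sub hfx hfφ, integral_mul_const]
    ring
  rw [e, ← integral_const_mul]
  refine (abs_cubeAvg_mul_toReal_le hμ hQ).trans ?_
  refine setIntegral_mono_on (hfx.sub hfφ).abs (hfQ.abs.const_mul δ) Q.measurableSet_set
    fun y hy => ?_
  rw [← mul_sub, abs_mul, mul_comm]
  exact mul_le_mul_of_nonneg_right (hδ y hy) (abs_nonneg _)

end

/-- if `f ∈ rbmo(μ)` and `φ` is `C¹` with compact support, then `fφ ∈ rbmo(μ)`. -/
theorem rbmoLoc_mul_smooth_compact_support
    {d n : ℕ} (μ : Measure (Euc d)) (C₀ η ρ β : ℝ)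
    (hn : 0 < n) (hnd : n ≤ d) (hC₀ : 0 < C₀)
    (hgrowth : ∀ x : Euc d, ∀ r : ℝ, 0 < r →
      μ (Metric.ball x r) ≤ ENNReal.ofReal (C₀ * r ^ n))
    (hgrowthQ : ∀ Q : Cube d, IsCube μ Q → μ Q.set ≤ ENNReal.ofReal (C₀ * Q.side ^ n))
    (hη : 1 < η) (hηρ : η ≤ ρ) (hρ : 1 < ρ) (hβ : ρ ^ n < β)
    (f φ : Euc d → ℝ) (hf : MemRbmoLoc μ n η ρ β f)
    (hφ : ContDiff ℝ 1 φ) (hφc : HasCompactSupport φ) :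
    MemRbmoLoc μ n η ρ β (fun x => f x * φ x) := by
  obtain ⟨hfi, C, hC, hfC⟩ := hf
  have hβ1 : 1 < β := (one_le_pow₀ hρ.le).trans_lt hβ
  have hβ0 : 0 < β := zero_lt_one.trans hβ1
  have hη0 : 0 < η := zero_lt_one.trans hη
  obtain ⟨K, hK, hKb⟩ :=
    exists_min_side_mul_integral_abs_le hC₀ hgrowthQ hη hηρ hρ hβ hfi hC hfC
  obtain ⟨M, hM⟩ := hφ.continuous.bounded_above_of_compact_support hφc
  have hM0 : 0 ≤ M := (norm_nonneg _).trans (hM 0)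
  simp only [Real.norm_eq_abs] at hM
  obtain ⟨D, hD, hDb⟩ := exists_abs_sub_le_min_side hφ hφc
  set g : Euc d → ℝ := fun x => f x * φ x with hg
  have hgi : LocallyIntegrable g μ := hfi.mul_continuous hφ.continuous
  have hosc (Q : Cube d) (hQ : IsCube μ Q) (x : Euc d) (hx : x ∈ Q.set) :
      |cubeAvg μ Q f * φ x - cubeAvg μ Q g| * (μ Q.set).toReal ≤
        D * K * (μ (Q.dilate η).set).toReal := by
    refine (abs_cubeAvg_mul_sub_cubeAvg_mul_le hgrowthQ hfi hφ.continuous hQ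
      (hDb Q hQ.1 x hx)).trans ?_
    rw [mul_assoc, mul_assoc]
    exact mul_le_mul_of_nonneg_left (hKb Q hQ) hD
  have hoscd (Q : Cube d) (hQ : IsCube μ Q) (hd : IsDoubling μ ρ β Q) (x : Euc d)
      (hx : x ∈ Q.set) : |cubeAvg μ Q f * φ x - cubeAvg μ Q g| ≤ D * K * β := by
    refine le_of_mul_le_mul_right ((hosc Q hQ x hx).trans ?_) (hQ.toReal_pos hgrowthQ)
    rw [mul_assoc (D * K)]
    exact mul_le_mul_of_nonneg_left (hd.toReal_le hgrowthQ hβ0.le hηρ hQ) (by positivity)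
  have hDKβ : 0 ≤ D * K * β := by positivity
  have hMC : 0 ≤ M * C := by positivity
  refine ⟨hgi, M * C + 2 * (D * K * β), by positivity, ?_, ?_, ?_⟩
  · intro Q hQ hQ1
    have hQη : (μ Q.set).toReal ≤ (μ (Q.dilate η).set).toReal :=
      (hQ.dilate hη0).toReal_mono hgrowthQ
        (Cube.set_mono Q.center (le_mul_of_one_le_left hQ.1.le hη.le))
    set a := cubeAvg μ (tilde μ ρ β Q) f
    set b := cubeAvg μ (tilde μ ρ β Q) g
    obtain ⟨B, hB, hBQ⟩ : ∃ B, (∀ x ∈ Q.set, |a * φ x - b| ≤ B) ∧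
        B * (μ Q.set).toReal ≤ D * K * β * (μ (Q.dilate η).set).toReal := by
      by_cases h : ∃ N : ℕ, IsDoubling μ ρ β (Q.dilate (2 ^ N))
      · exact ⟨D * K * β, fun x hx => hoscd _ hQ.tilde (isDoubling_tilde h) x
          (set_subset_tilde hQ.1.le hx), mul_le_mul_of_nonneg_left hQη hDKβ⟩
      · have h0 := hQ.toReal_pos hgrowthQ
        refine ⟨D * K * (μ (Q.dilate η).set).toReal / (μ Q.set).toReal, fun x hx => ?_, ?_⟩
        · rw [le_div_iff₀ h0]
          simpa only [a, b, tilde_eq_self h] using hosc Q hQ x hx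
        · rw [div_mul_cancel₀ _ h0.ne']
          exact mul_le_mul_of_nonneg_right
            (le_mul_of_one_le_right (by positivity) hβ1.le) ENNReal.toReal_nonneg
    have hconst (c : ℝ) : IntegrableOn (fun _ : Euc d => c) Q.set μ :=
      integrableOn_const (hQ.measure_ne_top hgrowthQ)
    have hfa : IntegrableOn (fun x => M * |f x - a|) Q.set μ :=
      (((integrableOn_cube hfi Q).sub (hconst a)).abs).const_mul M
    have hgb : IntegrableOn (fun x => |g x - b|) Q.set μ :=
      ((integrableOn_cube hgi Q).sub (hconst b)).abs
    calc ∫ x in Q.set, |g x - b| ∂μ ≤ ∫ x in Q.set, (M * |f x - a| + B) ∂μ := by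
          refine setIntegral_mono_on hgb (hfa.add (hconst B)) Q.measurableSet_set fun x hx => ?_
          have e : g x - b = (f x - a) * φ x + (a * φ x - b) := by simp only [hg]; ring
          rw [e]
          refine (abs_add_le _ _).trans (add_le_add ?_ (hB x hx))
          rw [abs_mul, mul_comm]
          exact mul_le_mul_of_nonneg_right (hM x) (abs_nonneg _)
      _ = M * (∫ x in Q.set, |f x - a| ∂μ) + B * (μ Q.set).toReal := by
          rw [integral_add hfa (hconst B), integral_const_mul, setIntegral_const, smul_eq_mul,
            mul_comm _ B]
          rfl
      _ ≤ M * (C * (μ (Q.dilate η).set).toReal) +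
          D * K * β * (μ (Q.dilate η).set).toReal :=
          add_le_add (mul_le_mul_of_nonneg_left (hfC.1 Q hQ hQ1) hM0) hBQ
      _ = (M * C + D * K * β) * (μ (Q.dilate η).set).toReal := by ring
      _ ≤ _ := mul_le_mul_of_nonneg_right (by linarith) ENNReal.toReal_nonneg
  · intro Q R hQ hR hQ1 hQR hQd hRd
    have hx := Cube.center_mem_set hQ.1.le
    have h1 := hoscd Q hQ hQd _ hx
    have h2 := hoscd R hR hRd _ (hQR hx)
    have h3 := hfC.2.1 Q R hQ hR hQ1 hQR hQd hRd
    have hS : 1 ≤ SQR μ n Q R := one_le_SQR hQ.1.le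
    set x := Q.center
    have e : cubeAvg μ Q g - cubeAvg μ R g =
        -(cubeAvg μ Q f * φ x - cubeAvg μ Q g) + (cubeAvg μ R f * φ x - cubeAvg μ R g) +
          φ x * (cubeAvg μ Q f - cubeAvg μ R f) := by ring
    calc |cubeAvg μ Q g - cubeAvg μ R g| ≤ D * K * β + D * K * β + M * (C * SQR μ n Q R) := by
          rw [e]
          refine (abs_add_le _ _).trans (add_le_add ((abs_add_le _ _).trans ?_) ?_)
          · rw [abs_neg]
            exact add_le_add h1 h2
          · rw [abs_mul]
            exact mul_le_mul (hM x) h3 (abs_nonneg _) hM0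
      _ = M * C * SQR μ n Q R + 2 * (D * K * β) * 1 := by ring
      _ ≤ M * C * SQR μ n Q R + 2 * (D * K * β) * SQR μ n Q R :=
          add_le_add_right (mul_le_mul_of_nonneg_left hS (by positivity)) _
      _ = _ := by ring
  · intro Q hQ hQ1
    calc ∫ x in Q.set, |g x| ∂μ ≤ ∫ x in Q.set, M * |f x| ∂μ := by
          refine integral_mono (integrableOn_cube hgi Q).abs
            ((integrableOn_cube hfi Q).abs.const_mul M) fun x => ?_
          simp only [hg]
          rw [abs_mul, mul_comm]
          exact mul_le_mul_of_nonneg_right (hM x) (abs_nonneg _)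
      _ = M * ∫ x in Q.set, |f x| ∂μ := integral_const_mul _ _
      _ ≤ M * (C * (μ (Q.dilate η).set).toReal) :=
          mul_le_mul_of_nonneg_left (hfC.2.2 Q hQ hQ1) hM0
      _ = M * C * (μ (Q.dilate η).set).toReal := by ring
      _ ≤ _ := mul_le_mul_of_nonneg_right (by linarith) ENNReal.toReal_nonneg
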